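/- Let ‖·‖ be a strictly convex C^{1,1} norm on ℝ², so that the dual norm ‖·‖_* is C¹ on ℝ²∖{0} and strongly convex. Let Ω, Ω° ⊂ ℝ² be the closed unit balls of ‖·‖ and ‖·‖_*, let P be an area parametrization of ∂Ω and Q an area parametrization of ∂Ω°, and let C : ℝ → ℝ be the continuous nondecreasing correspondence map characterized by ⟨P(C(s)), Q(s)⟩ = 1 for every s ∈ ℝ. If ψ₀ ∈ ℝ is such that the dual norm ‖·‖_* admits a second-order Taylor expansion at Q(ψ₀) (i.e. there is a symmetric bilinear form B with ‖Q(ψ₀)+w‖_* = 1 + d_{Q(ψ₀)}‖·‖_*(w) + ½B(w,w) + o(|w|²) as w → 0), then C is differentiable at ψ₀ and C′(ψ₀) > 0. -/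

import Mathlib

open MeasureTheory

/-- A (symmetric) norm on `ℝ × ℝ`. -/
structure IsNorm2 (nrm : ℝ × ℝ → ℝ) : Prop where
  eq_zero_iff : ∀ x, nrm x = 0 ↔ x = 0
  smul_eq : ∀ (a : ℝ) (x : ℝ × ℝ), nrm (a • x) = |a| * nrm x
  triangle : ∀ x y, nrm (x + y) ≤ nrm x + nrm y

/-- `nrm` is `C^{1,1}` on `ℝ² ∖ {0}`: differentiable there, with locally Lipschitz derivative. -/
def IsC11Away (nrm : ℝ × ℝ → ℝ) : Prop :=
  DifferentiableOn ℝ nrm {x | x ≠ 0} ∧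
    ∀ x : ℝ × ℝ, x ≠ 0 → ∃ ε > (0:ℝ), ∃ K : NNReal,
      LipschitzOnWith K (fderiv ℝ nrm) (Metric.ball x ε \ {0})

/-- The Euclidean pairing on `ℝ × ℝ`. -/
def dot2 (p q : ℝ × ℝ) : ℝ := p.1 * q.1 + p.2 * q.2

/-- The polar set of a subset of `ℝ²`. -/
def polar2 (K : Set (ℝ × ℝ)) : Set (ℝ × ℝ) := {q | ∀ x ∈ K, dot2 q x ≤ 1}

/-- The closed unit ball of the norm `nrm`. -/
def unitBall2 (nrm : ℝ × ℝ → ℝ) : Set (ℝ × ℝ) := {x | nrm x ≤ 1}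

/-- An area parametrization of the boundary of `K`: a locally Lipschitz curve tracing
`frontier K` which sweeps area at unit rate, i.e. `R₁ R₂′ − R₂ R₁′ = 1` a.e.
(equivalently `R θ = (cos_K θ, sin_K θ)` in the paper's convex trigonometry). -/
structure IsAreaParam (K : Set (ℝ × ℝ)) (R : ℝ → ℝ × ℝ) : Prop where
  lipschitz : LocallyLipschitz R
  mem_frontier : ∀ θ, R θ ∈ frontier K
  area : ∀ᵐ θ : ℝ ∂volume, ∃ v : ℝ × ℝ, HasDerivAt R v θ ∧ (R θ).1 * v.2 - (R θ).2 * v.1 = 1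

open Asymptotics

/-- The dual norm of `nrm` on `ℝ²` (via the Euclidean pairing). -/
noncomputable def dualNorm2 (nrm : ℝ × ℝ → ℝ) (q : ℝ × ℝ) : ℝ :=
  sSup {r | ∃ u, nrm u ≤ 1 ∧ r = dot2 q u}

open Filter Topology

/-- A locally Lipschitz function whose derivative agrees almost everywhere with a continuous
function is differentiable everywhere. -/
theorem LocallyLipschitz.hasDerivAt_of_ae {F : Type*} [NormedAddCommGroup F] [NormedSpace ℝ F]
    [CompleteSpace F] {f g : ℝ → F} (hf : LocallyLipschitz f) (hg : Continuous g)
    (h : ∀ᵐ x, HasDerivAt f (g x) x) (x : ℝ) : HasDerivAt f (g x) x := by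
  set G : ℝ → F := fun y => ∫ t in (0 : ℝ)..y, g t
  have hG : ∀ y, HasDerivAt G (g y) y := fun y => hg.integral_hasStrictDerivAt 0 y |>.hasDerivAt
  have hGlip : LocallyLipschitz G := by
    refine ContDiff.locallyLipschitz (𝕂 := ℝ) (contDiff_one_iff_deriv.2
      ⟨fun y => (hG y).differentiableAt, ?_⟩)
    rwa [show deriv G = g from funext fun y => (hG y).deriv]
  obtain ⟨K, hK⟩ := (hf.sub hGlip).locallyLipschitzOn.exists_lipschitzOnWith_of_compact
    (isCompact_uIcc (a := x - 1) (b := x + 1))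
  obtain ⟨c, hc⟩ := hK.absolutelyContinuousOnInterval.const_of_ae_hasDerivAt_zero
    (h.mono fun y hy _ => by simpa using! hy.sub (hG y))
  have hev : f =ᶠ[𝓝 x] fun y => c + G y := by
    filter_upwards [Icc_mem_nhds (show x - 1 < x by linarith) (show x < x + 1 by linarith)]
      with y hy
    rw [← hc y (Set.Icc_subset_uIcc hy)]
    simp
  exact ((hG x).const_add c).congr_of_eventuallyEq hev

/-- If `f` has a second-order Taylor expansion at `x₀`, then its subgradients have a first-order
expansion at `x₀`. -/
theorem eventually_norm_subgradient_sub_le {E : Type*} [NormedAddCommGroup E] [NormedSpace ℝ E]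
    {f : E → ℝ} {x₀ : E} {D : E →L[ℝ] ℝ} {B : E →L[ℝ] E →L[ℝ] ℝ}
    (hB : ∀ v w, B v w = B w v) (hD : HasFDerivAt f D x₀)
    (hT : (fun w => f (x₀ + w) - (f x₀ + D w + B w w / 2)) =o[𝓝 0] fun w => ‖w‖ ^ 2)
    {ε : ℝ} (hε : 0 < ε) :
    ∀ᶠ w in 𝓝 (0 : E), ∀ l : E →L[ℝ] ℝ, (∀ v, f (x₀ + w) + l v ≤ f (x₀ + w + v)) →
      ‖l - D - B w‖ ≤ ε * ‖w‖ := by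
  set M : ℝ := ‖B‖ / 2 + 5
  have hM : 0 < M := by positivity
  set ρ : ℝ := min 1 (ε / M)
  have hρ : 0 < ρ := by positivity
  have hρ1 : ρ ≤ 1 := min_le_left _ _
  have hρM : M * ρ ≤ ε := by
    have : ρ ≤ ε / M := min_le_right _ _
    rwa [le_div_iff₀' hM] at this
  obtain ⟨r, hr, hball⟩ := Metric.eventually_nhds_iff.1 (hT.bound (sq_pos_of_pos hρ))
  refine Metric.eventually_nhds_iff.2 ⟨r / 2, by positivity, fun w hw l hl => ?_⟩
  rw [dist_zero_right] at hw
  rcases eq_or_ne w 0 with rfl | hw0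
  · have hmin : IsLocalMin (fun y => f y - l (y - x₀)) x₀ := Filter.Eventually.of_forall fun y => by
      have := hl (y - x₀)
      simp only [add_zero, add_sub_cancel] at this
      simp only [sub_self, map_zero]
      linarith
    have hder : HasFDerivAt (fun y => f y - l (y - x₀)) (D - l) x₀ := by
      have hsub : HasFDerivAt (fun y : E => y - x₀) (.id ℝ E) x₀ := (hasFDerivAt_id x₀).sub_const x₀
      exact hD.sub (l.hasFDerivAt.comp x₀ hsub)
    rw [sub_eq_zero.1 (hmin.hasFDerivAt_eq_zero hder)]
    simp
  have hδ : 0 < ‖w‖ := norm_pos_iff.2 hw0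
  have key : ∀ v, ‖v‖ ≤ ρ * ‖w‖ → (l - D - B w) v ≤ M * ρ ^ 2 * ‖w‖ ^ 2 := by
    intro v hv
    have hv1 : ‖v‖ ≤ ‖w‖ := hv.trans (by nlinarith)
    have hwv : ‖w + v‖ ≤ 2 * ‖w‖ := (norm_add_le _ _).trans (by linarith)
    have e1 := hball (y := w) (by rw [dist_zero_right]; linarith)
    have e2 := hball (y := w + v) (by rw [dist_zero_right]; linarith)
    simp only [Real.norm_eq_abs, abs_pow, abs_norm] at e1 e2
    have e3 : ρ ^ 2 * ‖w + v‖ ^ 2 ≤ ρ ^ 2 * (2 * ‖w‖) ^ 2 := by gcongr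
    have e4 : B v v ≤ ‖B‖ * (ρ * ‖w‖) ^ 2 := by
      calc B v v ≤ ‖B v v‖ := Real.le_norm_self _
        _ ≤ ‖B‖ * ‖v‖ * ‖v‖ := B.le_opNorm₂ v v
        _ = ‖B‖ * ‖v‖ ^ 2 := by ring
        _ ≤ _ := by gcongr
    have e5 := hl v
    rw [abs_le] at e1 e2
    simp only [← add_assoc, map_add, add_apply] at e2
    simp only [sub_apply]
    have := hB v w
    simp only [M]
    nlinarith [e1.1, e2.2]
  have hnorm : ‖l - D - B w‖ ≤ M * ρ ^ 2 * ‖w‖ ^ 2 / (ρ * ‖w‖) := by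
    refine ContinuousLinearMap.opNorm_bound_of_ball_bound (by positivity) _ _ fun z hz => ?_
    rw [mem_closedBall_zero_iff] at hz
    refine abs_le.2 ⟨?_, key z hz⟩
    have := key (-z) (by rwa [norm_neg])
    rw [map_neg] at this
    linarith
  refine hnorm.trans ?_
  rw [show M * ρ ^ 2 * ‖w‖ ^ 2 / (ρ * ‖w‖) = M * ρ * ‖w‖ by field_simp]
  gcongr

/-- A continuous right factor of a differentiable composition is differentiable where the left
factor has a nonzero strict derivative. -/
theorem HasStrictDerivAt.hasDerivAt_of_comp {F C : ℝ → ℝ} {a b x : ℝ}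
    (hF : HasStrictDerivAt F a (C x)) (ha : a ≠ 0) (hC : ContinuousAt C x)
    (h : HasDerivAt (F ∘ C) b x) : HasDerivAt C (a⁻¹ * b) x := by
  have h1 : HasDerivAt (hF.localInverse F a (C x) ha) a⁻¹ ((F ∘ C) x) :=
    (hF.to_localInverse ha).hasDerivAt
  refine (h1.comp x h).congr_of_eventuallyEq ?_
  filter_upwards [hC.eventually (hF.eventually_left_inverse ha)] with y hy
  exact hy.symm

/-- The Euclidean pairing as a continuous bilinear map. -/
noncomputable def dot2L : (ℝ × ℝ) →L[ℝ] (ℝ × ℝ) →L[ℝ] ℝ :=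
  (ContinuousLinearMap.fst ℝ ℝ ℝ).smulRight (ContinuousLinearMap.fst ℝ ℝ ℝ) +
    (ContinuousLinearMap.snd ℝ ℝ ℝ).smulRight (ContinuousLinearMap.snd ℝ ℝ ℝ)

@[simp]
theorem dot2L_apply (p q : ℝ × ℝ) : dot2L p q = dot2 p q := by
  simp [dot2L, dot2]

theorem dot2_comm (p q : ℝ × ℝ) : dot2 p q = dot2 q p := by
  simp only [dot2]; ring

/-- An area parametrization whose position vector is normalized by a continuous conormal field
moves with the quarter turn of this field as velocity. -/
theorem IsAreaParam.hasDerivAt {K : Set (ℝ × ℝ)} {R G : ℝ → ℝ × ℝ} (hR : IsAreaParam K R)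
    (hG : Continuous G) (hRG : ∀ t, dot2 (R t) (G t) = 1)
    (hperp : ∀ t v, HasDerivAt R v t → dot2 v (G t) = 0) (t : ℝ) :
    HasDerivAt R (-(G t).2, (G t).1) t := by
  refine hR.lipschitz.hasDerivAt_of_ae (g := fun t => (-(G t).2, (G t).1)) (by fun_prop) ?_ t
  filter_upwards [hR.area] with s ⟨v, hv, harea⟩
  have h1 := hRG s
  have h2 := hperp s v hv
  simp only [dot2] at h1 h2
  have : v = (-(G s).2, (G s).1) := by
    ext
    · linear_combination (-v.1) * h1 + (R s).1 * h2 - (G s).2 * harea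
    · linear_combination (-v.2) * h1 + (R s).2 * h2 + (G s).1 * harea
  rwa [← this]

namespace IsNorm2

variable {nrm : ℝ × ℝ → ℝ} (h : IsNorm2 nrm)
include h

theorem map_zero : nrm 0 = 0 := (h.eq_zero_iff 0).2 rfl

theorem map_neg (x : ℝ × ℝ) : nrm (-x) = nrm x := by
  simpa using h.smul_eq (-1) x

theorem nonneg (x : ℝ × ℝ) : 0 ≤ nrm x := by
  have := h.triangle x (-x)
  rw [add_neg_cancel, h.map_zero, h.map_neg] at this
  linarith

theorem pos {x : ℝ × ℝ} (hx : x ≠ 0) : 0 < nrm x :=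
  (h.nonneg x).lt_of_ne fun h0 => hx ((h.eq_zero_iff x).1 h0.symm)

theorem le_mul_norm (x : ℝ × ℝ) : nrm x ≤ (nrm (1, 0) + nrm (0, 1)) * ‖x‖ := by
  have hx : x = x.1 • ((1, 0) : ℝ × ℝ) + x.2 • ((0, 1) : ℝ × ℝ) := by ext <;> simp
  calc nrm x ≤ nrm (x.1 • ((1, 0) : ℝ × ℝ)) + nrm (x.2 • ((0, 1) : ℝ × ℝ)) := by
        conv_lhs => rw [hx]
        exact h.triangle _ _
    _ = |x.1| * nrm (1, 0) + |x.2| * nrm (0, 1) := by rw [h.smul_eq, h.smul_eq]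
    _ ≤ ‖x‖ * nrm (1, 0) + ‖x‖ * nrm (0, 1) :=
        add_le_add (mul_le_mul_of_nonneg_right (norm_fst_le x) (h.nonneg _))
          (mul_le_mul_of_nonneg_right (norm_snd_le x) (h.nonneg _))
    _ = _ := by ring

theorem continuous : Continuous nrm := by
  refine (LipschitzWith.of_le_add_mul (nrm (1, 0) + nrm (0, 1)).toNNReal fun x y => ?_).continuous
  rw [Real.coe_toNNReal _ (add_nonneg (h.nonneg _) (h.nonneg _)), dist_eq_norm]
  have h1 := h.triangle y (x - y)
  rw [add_sub_cancel] at h1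
  linarith [h.le_mul_norm (x - y)]

theorem exists_norm_le_mul : ∃ c, 0 ≤ c ∧ ∀ x, ‖x‖ ≤ c * nrm x := by
  obtain ⟨z, hz, hmin⟩ := (isCompact_sphere (0 : ℝ × ℝ) 1).exists_isMinOn
    (NormedSpace.sphere_nonempty.2 zero_le_one) h.continuous.continuousOn
  have hz0 : z ≠ 0 := ne_zero_of_mem_unit_sphere ⟨z, hz⟩
  refine ⟨(nrm z)⁻¹, inv_nonneg.2 (h.nonneg z), fun x => ?_⟩
  rcases eq_or_ne x 0 with rfl | hx
  · simp [h.map_zero]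
  have hxn : 0 < ‖x‖ := norm_pos_iff.2 hx
  have h1 : nrm z ≤ nrm (‖x‖⁻¹ • x) := hmin (by simp [norm_smul, hxn.ne'])
  rw [h.smul_eq, abs_of_pos (inv_pos.2 hxn), inv_mul_eq_div, le_div_iff₀ hxn] at h1
  rwa [inv_mul_eq_div, le_div_iff₀ (h.pos hz0), mul_comm]

theorem eq_one_of_mem_frontier {x : ℝ × ℝ} (hx : x ∈ frontier (unitBall2 nrm)) : nrm x = 1 :=
  frontier_le_subset_eq h.continuous continuous_const hx

theorem dot2_le {q : ℝ × ℝ} (hq : q ∈ polar2 (unitBall2 nrm)) (x : ℝ × ℝ) :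
    dot2 q x ≤ nrm x := by
  rcases eq_or_ne x 0 with rfl | hx
  · simp [dot2, h.map_zero]
  have hx' := h.pos hx
  have h1 := hq ((nrm x)⁻¹ • x) (by
    simp [unitBall2, h.smul_eq, abs_of_pos hx', hx'.ne'])
  rw [← dot2L_apply, _root_.map_smul, smul_eq_mul, inv_mul_eq_div, div_le_one hx',
    dot2L_apply] at h1
  exact h1

theorem le_dualNorm2 (q : ℝ × ℝ) {u : ℝ × ℝ} (hu : nrm u ≤ 1) : dot2 q u ≤ dualNorm2 nrm q := by
  obtain ⟨c, hc, hle⟩ := h.exists_norm_le_mul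
  refine le_csSup ⟨‖dot2L‖ * ‖q‖ * c, ?_⟩ ⟨u, hu, rfl⟩
  rintro _ ⟨y, hy, rfl⟩
  rw [← dot2L_apply]
  refine (Real.le_norm_self _).trans ((dot2L.le_opNorm₂ q y).trans ?_)
  gcongr
  exact (hle y).trans (mul_le_of_le_one_right hc hy)

theorem dualNorm2_eq_one {q u : ℝ × ℝ} (hq : q ∈ polar2 (unitBall2 nrm)) (hu : nrm u ≤ 1)
    (hqu : dot2 q u = 1) : dualNorm2 nrm q = 1 := by
  refine le_antisymm (csSup_le ⟨_, u, hu, rfl⟩ ?_) (hqu ▸ h.le_dualNorm2 q hu)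
  rintro _ ⟨y, hy, rfl⟩
  exact hq y hy

theorem fderiv_apply_self {x : ℝ × ℝ} (hd : DifferentiableAt ℝ nrm x) :
    fderiv ℝ nrm x x = nrm x := by
  have h1 : HasDerivAt (fun t : ℝ => nrm (t • x)) (fderiv ℝ nrm x x) 1 := by
    have hs : HasDerivAt (fun t : ℝ => t • x) x 1 := by
      simpa using (hasDerivAt_id (1 : ℝ)).smul_const x
    have hd' : HasFDerivAt nrm (fderiv ℝ nrm x) ((1 : ℝ) • x) := by
      rw [one_smul]; exact hd.hasFDerivAt
    exact hd'.comp_hasDerivAt 1 hs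
  have h2 : HasDerivAt (fun t : ℝ => nrm (t • x)) (nrm x) 1 := by
    have hs : HasDerivAt (fun t : ℝ => t * nrm x) (nrm x) 1 := by
      simpa using (hasDerivAt_id (1 : ℝ)).mul_const (nrm x)
    refine hs.congr_of_eventuallyEq ?_
    filter_upwards [lt_mem_nhds (zero_lt_one (α := ℝ))] with t ht
    rw [h.smul_eq, abs_of_pos ht]
  exact h1.unique h2

/-- A polar vector touching the norm at `x` is the derivative of the norm at `x`. -/
theorem fderiv_eq_of_mem_polar2 {x q : ℝ × ℝ} (hd : DifferentiableAt ℝ nrm x)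
    (hq : q ∈ polar2 (unitBall2 nrm)) (hqx : dot2 q x = nrm x) :
    fderiv ℝ nrm x = dot2L q := by
  have hmin : IsLocalMin (fun y => nrm y - dot2L q y) x := Filter.Eventually.of_forall fun y => by
    have := h.dot2_le hq y
    simp only [dot2L_apply]
    linarith
  exact sub_eq_zero.1 (hmin.hasFDerivAt_eq_zero (hd.hasFDerivAt.sub (dot2L q).hasFDerivAt))

end IsNorm2

theorem isClosed_polar2 (K : Set (ℝ × ℝ)) : IsClosed (polar2 K) := by
  simp only [polar2, Set.ofPred_forall]
  refine isClosed_biInter fun x _ => isClosed_le ?_ continuous_const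
  unfold dot2
  fun_prop

namespace IsC11Away

variable {nrm : ℝ × ℝ → ℝ} (h : IsC11Away nrm)
include h

theorem differentiableAt {x : ℝ × ℝ} (hx : x ≠ 0) : DifferentiableAt ℝ nrm x :=
  h.1.differentiableAt (isOpen_ne.mem_nhds hx)

theorem exists_lipschitzOnWith_nhds {x : ℝ × ℝ} (hx : x ≠ 0) :
    ∃ K, ∃ s ∈ 𝓝 x, LipschitzOnWith K (fderiv ℝ nrm) s := by
  obtain ⟨ε, hε, K, hK⟩ := h.2 x hx
  exact ⟨K, _, Filter.inter_mem (Metric.ball_mem_nhds x hε) (isOpen_ne.mem_nhds hx), hK⟩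

theorem continuousAt_fderiv {x : ℝ × ℝ} (hx : x ≠ 0) : ContinuousAt (fderiv ℝ nrm) x := by
  obtain ⟨K, s, hs, hK⟩ := h.exists_lipschitzOnWith_nhds hx
  exact hK.continuousOn.continuousAt hs

end IsC11Away

/-- If the dual norm admits a second-order Taylor expansion at `Q(ψ₀)`, then the
correspondence map `C` (with `⟨P(C(s)), Q(s)⟩ = 1`) is differentiable at `ψ₀` with
positive derivative. -/
theorem correspondence_differentiable_at_twice_diff_point
    (nrm : ℝ × ℝ → ℝ) (h1 : IsNorm2 nrm)
    (h2 : StrictConvexOn ℝ Set.univ fun x => (nrm x) ^ 2)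
    (h3 : IsC11Away nrm)
    (P : ℝ → ℝ × ℝ) (hP : IsAreaParam (unitBall2 nrm) P)
    (Q : ℝ → ℝ × ℝ) (hQ : IsAreaParam (polar2 (unitBall2 nrm)) Q)
    (C : ℝ → ℝ) (hCmono : Monotone C) (hCcont : Continuous C)
    (hCorr : ∀ s, dot2 (P (C s)) (Q s) = 1)
    (ψ₀ : ℝ)
    (hTaylor : ∃ (D : (ℝ × ℝ) →L[ℝ] ℝ) (B : (ℝ × ℝ) →L[ℝ] (ℝ × ℝ) →L[ℝ] ℝ),
      (∀ v w, B v w = B w v) ∧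
      HasFDerivAt (dualNorm2 nrm) D (Q ψ₀) ∧
      (fun w => dualNorm2 nrm (Q ψ₀ + w) - (1 + D w + B w w / 2))
        =o[nhds (0 : ℝ × ℝ)] fun w => ‖w‖ ^ 2) :
    ∃ c : ℝ, 0 < c ∧ HasDerivAt C c ψ₀ := by
  obtain ⟨D, B, hB, hD, hT⟩ := hTaylor
  have hPn : ∀ t, nrm (P t) = 1 := fun t => h1.eq_one_of_mem_frontier (hP.mem_frontier t)
  have hP0 : ∀ t, P t ≠ 0 := fun t h0 => by simpa [h0, h1.map_zero] using hPn t
  have hQpol : ∀ s, Q s ∈ polar2 (unitBall2 nrm) := fun s =>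
    (isClosed_polar2 _).frontier_subset (hQ.mem_frontier s)
  have hQP : ∀ s, dot2 (Q s) (P (C s)) = 1 := fun s => by rw [dot2_comm, hCorr]
  have hPc : Continuous P := hP.lipschitz.continuous
  have hdiff : ∀ t, DifferentiableAt ℝ nrm (P t) := fun t => h3.differentiableAt (hP0 t)
  have hQ' : ∀ s, HasDerivAt Q (-(P (C s)).2, (P (C s)).1) s := by
    refine hQ.hasDerivAt (hPc.comp hCcont) (fun s => hQP s) fun s v hv => ?_
    have hmax : IsLocalMax (fun t => dot2L (P (C s)) (Q t)) s := Eventually.of_forall fun t => by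
      simp only [dot2L_apply, hCorr]
      rw [dot2_comm]
      exact hQpol t _ (hPn _).le
    have := hmax.hasDerivAt_eq_zero ((dot2L (P (C s))).hasFDerivAt.comp_hasDerivAt s hv)
    rwa [dot2L_apply, dot2_comm] at this
  set N : ℝ → ℝ × ℝ := fun t => (fderiv ℝ nrm (P t) (1, 0), fderiv ℝ nrm (P t) (0, 1))
  have hNapply : ∀ t v, dot2 v (N t) = fderiv ℝ nrm (P t) v := fun t v => by
    have hv : v = v.1 • ((1, 0) : ℝ × ℝ) + v.2 • ((0, 1) : ℝ × ℝ) := by ext <;> simp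
    conv_rhs => rw [hv, map_add, map_smul, map_smul]
    rfl
  have hNc : Continuous N := by
    have : Continuous fun t => fderiv ℝ nrm (P t) := continuous_iff_continuousAt.2 fun t =>
      (h3.continuousAt_fderiv (hP0 t)).comp hPc.continuousAt
    fun_prop
  have hPN : ∀ t, dot2 (P t) (N t) = 1 := fun t => by
    rw [hNapply, h1.fderiv_apply_self (hdiff t), hPn]
  have hP' : ∀ t, HasDerivAt P (-(N t).2, (N t).1) t := by
    refine hP.hasDerivAt hNc hPN fun t v hv => ?_
    have hc := (hdiff t).hasFDerivAt.comp_hasDerivAt t hv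
    rw [show nrm ∘ P = fun _ => 1 from funext hPn] at hc
    rw [hNapply]
    exact hc.unique (hasDerivAt_const t 1)
  set Q₁ : ℝ × ℝ := (-(P (C ψ₀)).2, (P (C ψ₀)).1)
  have hQ₁ : Q₁ ≠ 0 := fun h0 => hP0 (C ψ₀) (by
    simp only [Q₁, Prod.mk_eq_zero, neg_eq_zero] at h0
    ext <;> simp [h0.1, h0.2])
  have hdual : ∀ s, dualNorm2 nrm (Q s) = 1 := fun s =>
    h1.dualNorm2_eq_one (hQpol s) (hPn _).le (hQP s)
  have hsub : ∀ s v, dualNorm2 nrm (Q s) + dot2L (P (C s)) v ≤ dualNorm2 nrm (Q s + v) := by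
    intro s v
    have := h1.le_dualNorm2 (Q s + v) (hPn (C s)).le
    rwa [dot2_comm, ← dot2L_apply, map_add, dot2L_apply, hCorr, ← hdual s] at this
  have hDeq : dot2L (P (C ψ₀)) = D := by
    have := (eventually_norm_subgradient_sub_le hB hD (by simpa only [hdual] using hT)
      one_pos).self_of_nhds (dot2L (P (C ψ₀))) (by simpa using hsub ψ₀)
    simpa [sub_eq_zero] using this
  have hQtend : Tendsto (fun s => Q s - Q ψ₀) (𝓝 ψ₀) (𝓝 0) := by
    have := ((hQ' ψ₀).continuousAt.tendsto).sub_const (Q ψ₀)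
    rwa [sub_self] at this
  have hlittle : (fun s => dot2L (P (C s)) - dot2L (P (C ψ₀)) - B (Q s - Q ψ₀)) =o[𝓝 ψ₀]
      fun s => Q s - Q ψ₀ := by
    refine Asymptotics.isLittleO_iff.2 fun ε hε => ?_
    filter_upwards [hQtend.eventually (eventually_norm_subgradient_sub_le hB hD
      (by simpa only [hdual] using hT) hε)] with s hs
    rw [hDeq]
    exact hs _ fun v => by simpa using hsub s v
  have hL : HasDerivAt (fun s => dot2L (P (C s))) (B Q₁) ψ₀ := by
    rw [hasDerivAt_iff_isLittleO]
    have hB' := hasDerivAt_iff_isLittleO.1 ((B.hasFDerivAt (x := Q ψ₀)).comp_hasDerivAt ψ₀ (hQ' ψ₀))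
    refine ((hlittle.trans_isBigO (hQ' ψ₀).isBigO_sub).add hB').congr_left fun s => ?_
    simp only [Function.comp, map_sub]
    abel
  set P₁ : ℝ × ℝ := (-(N (C ψ₀)).2, (N (C ψ₀)).1) with hP₁
  have hP₁pos : 0 < dot2 P₁ P₁ := by
    have h0 := hPN (C ψ₀)
    simp only [dot2, hP₁] at h0 ⊢
    by_contra! hle
    have ha : (N (C ψ₀)).1 = 0 := by nlinarith [sq_nonneg (N (C ψ₀)).1, sq_nonneg (N (C ψ₀)).2]
    have hb : (N (C ψ₀)).2 = 0 := by nlinarith [sq_nonneg (N (C ψ₀)).1, sq_nonneg (N (C ψ₀)).2]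
    simp [ha, hb] at h0
  have hPstrict : HasStrictDerivAt P P₁ (C ψ₀) :=
    hasStrictDerivAt_of_hasDerivAt_of_continuousAt (f' := fun t => (-(N t).2, (N t).1))
      (Eventually.of_forall hP') (by fun_prop)
  have hC : HasDerivAt C ((dot2 P₁ P₁)⁻¹ * B Q₁ P₁) ψ₀ := by
    have hF : HasStrictDerivAt (fun t => dot2L (P t) P₁) (dot2 P₁ P₁) (C ψ₀) := by
      have := (dot2L.flip P₁).hasStrictFDerivAt.comp_hasStrictDerivAt (C ψ₀) hPstrict
      simpa using! this
    exact hF.hasDerivAt_of_comp hP₁pos.ne' hCcont.continuousAt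
      ((ContinuousLinearMap.apply ℝ ℝ P₁).hasFDerivAt.comp_hasDerivAt ψ₀ hL)
  refine ⟨_, ?_, hC⟩
  have hnonneg := hC.deriv ▸ hCmono.deriv_nonneg (x := ψ₀)
  refine hnonneg.lt_of_ne fun hzero => hQ₁ ?_
  rw [← hzero] at hC
  have hPC : HasDerivAt (fun s => P (C s)) 0 ψ₀ := by
    simpa using! (hP' (C ψ₀)).scomp ψ₀ hC
  obtain ⟨K, s, hs, hK⟩ := h3.exists_lipschitzOnWith_nhds (hP0 (C ψ₀))
  have hfd : ∀ t, fderiv ℝ nrm (P (C t)) = dot2L (Q t) := fun t =>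
    h1.fderiv_eq_of_mem_polar2 (hdiff _) (hQpol t) (by rw [hQP, hPn])
  have hbig : (fun t => dot2L (Q t) - dot2L (Q ψ₀)) =O[𝓝 ψ₀] fun t => P (C t) - P (C ψ₀) := by
    refine Asymptotics.IsBigO.of_bound K ?_
    filter_upwards [(hPc.comp hCcont).continuousAt.eventually_mem hs] with t ht
    rw [← hfd, ← hfd]
    exact hK.norm_sub_le ht (mem_of_mem_nhds hs)
  have hzeroQ : HasDerivAt (fun t => dot2L (Q t)) 0 ψ₀ := by
    rw [hasDerivAt_iff_isLittleO] at hPC ⊢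
    simp only [smul_zero, sub_zero] at hPC ⊢
    exact hbig.trans_isLittleO hPC
  have hQL := (dot2L.hasFDerivAt (x := Q ψ₀)).comp_hasDerivAt ψ₀ (hQ' ψ₀)
  have heq : dot2L Q₁ = 0 := hQL.unique hzeroQ
  have e1 := congrArg (fun l : (ℝ × ℝ) →L[ℝ] ℝ => l (1, 0)) heq
  have e2 := congrArg (fun l : (ℝ × ℝ) →L[ℝ] ℝ => l (0, 1)) heq
  simp only [dot2L_apply, dot2, zero_apply, mul_one, mul_zero, add_zero,
    zero_add] at e1 e2
  exact Prod.ext e1 e2
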